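/- arXiv:2209.04046 — 4 statements merged into one kernel-verified Lean document; each statement's English description precedes it below -/
import Mathlib

section
/- Let A be a complete regular local ring with perfect residue field of characteristic p > 0 and A_∞,0^{nc} the union of the rings A_n = A[x_1^{1/p^n},…,x_d^{1/p^n}] for a fixed regular system of parameters x_1,…,x_d. The normalized length λ_∞ is additive on short exact sequences: if 0 → M' → M → M'' → 0 is a short exact sequence of m_A-power-torsion A_∞,0^{nc}-modules, then λ_∞(M) = λ_∞(M') + λ_∞(M''). -/
universe u

open IsLocalRing

/-- The length of an `R`-module `M`, valued in `ℝ≥0∞`: the supremum of the lengths of chains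
of submodules of `M`. -/
noncomputable def moduleLength (R M : Type*) [Semiring R] [AddCommGroup M] [Module R M] :
    ENNReal :=
  ⨆ s : LTSeries (Submodule R M), (s.length : ENNReal)

/-- The `n`-th level `A_n = A[x_1^{1/pⁿ}, …, x_d^{1/pⁿ}]` of the tower whose union is
`A_∞,0^{nc}`, realized as the subalgebra of `B` generated by the chosen compatible
`pⁿ`-th roots `ξ i n` of the regular system of parameters. -/
noncomputable def rootLevel (A B : Type u) [CommRing A] [CommRing B] [Algebra A B]
    {d : ℕ} (ξ : Fin d → ℕ → B) (n : ℕ) : Subalgebra A B :=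
  Algebra.adjoin A (Set.range fun i => ξ i n)

/-- For a `B`-module `M` and a set `S ⊆ M` of generators, the `A`-submodule `S·A_n`
generated by all `A_n`-multiples of elements of `S`. -/
noncomputable def levelSpan (A B : Type u) [CommRing A] [CommRing B] [Algebra A B]
    {d : ℕ} (ξ : Fin d → ℕ → B) (n : ℕ) (M : Type u) [AddCommGroup M] [Module A M]
    [Module B M] (S : Set M) : Submodule A M :=
  Submodule.span A {y : M | ∃ b ∈ rootLevel A B ξ n, ∃ s ∈ S, y = b • s}

/-- **Faltings' normalized length** of an `A_∞,0^{nc}`-module `M` (where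
`B = A_∞,0^{nc} = ∪ₙ Aₙ`): the supremum, over finitely generated `B`-submodules `N` of `M`,
of the infimum over finite generating sets `S` of `N` and levels `n` of
`length_A(S·A_n)/p^{nd}`. -/
noncomputable def normalizedLength (A B : Type u) [CommRing A] [CommRing B] [Algebra A B]
    (p : ℕ) {d : ℕ} (ξ : Fin d → ℕ → B) (M : Type u) [AddCommGroup M] [Module A M]
    [Module B M] : ENNReal :=
  ⨆ (N : Submodule B M) (_ : N.FG),
    ⨅ (S : Finset M) (_ : Submodule.span B (S : Set M) = N) (n : ℕ),
      moduleLength A ↥(levelSpan A B ξ n M (S : Set M)) / (p : ENNReal) ^ (n * d)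

section Length

variable {A : Type*} [CommRing A] {M N : Type*} [AddCommGroup M] [Module A M]
  [AddCommGroup N] [Module A N]

theorem moduleLength_eq_toENNReal : moduleLength A M = (Module.length A M : ENNReal) := by
  rw [Module.length_eq_height, Order.height]
  simp [moduleLength]

theorem moduleLength_le_of_injective (f : M →ₗ[A] N) (hf : Function.Injective f) :
    moduleLength A M ≤ moduleLength A N := by
  simpa [moduleLength_eq_toENNReal] using Module.length_le_of_injective f hf

theorem moduleLength_mono {P Q : Submodule A M} (h : P ≤ Q) :
    moduleLength A P ≤ moduleLength A Q :=
  moduleLength_le_of_injective (Submodule.inclusion h) (Submodule.inclusion_injective h)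

theorem moduleLength_map_le (g : M →ₗ[A] N) (Q : Submodule A M) :
    moduleLength A (Q.map g) ≤ moduleLength A Q := by
  simpa [moduleLength_eq_toENNReal] using
    Module.length_le_of_surjective (g.submoduleMap Q) (g.submoduleMap_surjective Q)

theorem moduleLength_map_eq (f : M →ₗ[A] N) (hf : Function.Injective f) (Q : Submodule A M) :
    moduleLength A (Q.map f) = moduleLength A Q := by
  simpa [moduleLength_eq_toENNReal] using (Submodule.equivMapOfInjective f hf Q).length_eq.symm

theorem moduleLength_eq_inf_ker_add_map (g : M →ₗ[A] N) (Q : Submodule A M) :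
    moduleLength A Q =
      moduleLength A ↥(Q ⊓ LinearMap.ker g) + moduleLength A (Q.map g) := by
  have h := Module.length_eq_add_of_exact
    (Submodule.inclusion (inf_le_left : Q ⊓ LinearMap.ker g ≤ Q)) (g.submoduleMap Q)
    (Submodule.inclusion_injective _) (g.submoduleMap_surjective Q) (by
      rintro ⟨y, hy⟩
      constructor
      · intro h
        exact ⟨⟨y, hy, by simpa using congrArg Subtype.val h⟩, rfl⟩
      · rintro ⟨⟨z, hz, hz'⟩, h⟩
        obtain rfl : z = y := congrArg Subtype.val h
        exact Subtype.ext hz')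
  simp only [moduleLength_eq_toENNReal, h, ENat.toENNReal_add]

theorem moduleLength_sup_le (P Q : Submodule A M) :
    moduleLength A ↥(P ⊔ Q) ≤ moduleLength A P + moduleLength A Q := by
  have h : (P ⊔ Q).map P.mkQ = Q.map P.mkQ := by simp
  rw [moduleLength_eq_inf_ker_add_map P.mkQ, h, Submodule.ker_mkQ]
  exact add_le_add (moduleLength_mono inf_le_right) (moduleLength_map_le _ _)

theorem moduleLength_map_mkQ_inf_ker (g : M →ₗ[A] N) (Q : Submodule A M) :
    moduleLength A (Q.map (Q ⊓ LinearMap.ker g).mkQ) = moduleLength A (Q.map g) := by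
  have hbot : Q.map (Q ⊓ LinearMap.ker g).mkQ ⊓
      LinearMap.ker ((Q ⊓ LinearMap.ker g).liftQ g inf_le_right) = ⊥ := by
    rw [eq_bot_iff]
    rintro _ ⟨⟨y, hy, rfl⟩, hy'⟩
    exact (Submodule.Quotient.mk_eq_zero _).2 ⟨hy, hy'⟩
  rw [moduleLength_eq_inf_ker_add_map ((Q ⊓ LinearMap.ker g).liftQ g inf_le_right), hbot,
    ← Submodule.map_comp, Submodule.liftQ_mkQ]
  simp [moduleLength_eq_toENNReal]

theorem moduleLength_finset_sup_le {ι : Type*} (s : Finset ι) (P : ι → Submodule A M) :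
    moduleLength A ↥(s.sup P) ≤ ∑ i ∈ s, moduleLength A (P i) := by
  classical
  induction s using Finset.induction_on with
  | empty => rw [Finset.sup_empty]; simp [moduleLength_eq_toENNReal]
  | insert i s hi ih =>
    rw [Finset.sup_insert, Finset.sum_insert hi]
    exact (moduleLength_sup_le _ _).trans (by gcongr)

end Length

section RootLevel

variable {A B : Type u} [CommRing A] [CommRing B] [Algebra A B] {p d : ℕ} {ξ : Fin d → ℕ → B}

theorem rootLevel_mono (hξ : ∀ i n, ξ i (n + 1) ^ p = ξ i n) : Monotone (rootLevel A B ξ) := by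
  refine monotone_nat_of_le_succ fun n => Algebra.adjoin_le ?_
  rintro _ ⟨i, rfl⟩
  change ξ i n ∈ rootLevel A B ξ (n + 1)
  rw [← hξ i n]
  exact pow_mem (Algebra.subset_adjoin (Set.mem_range_self i)) p

theorem exists_finset_rootLevel_succ (hp : 0 < p) (hξ : ∀ i n, ξ i (n + 1) ^ p = ξ i n) (n : ℕ) :
    ∃ E : Finset B, E.card ≤ p ^ d ∧ (∀ e ∈ E, e ∈ rootLevel A B ξ (n + 1)) ∧
      ∀ b ∈ rootLevel A B ξ (n + 1),
        b ∈ Submodule.span (rootLevel A B ξ n) (E : Set B) := by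
  classical
  let mon : (Fin d → ℕ) → B := fun e => ∏ i, ξ i (n + 1) ^ e i
  let I : Finset (Fin d → ℕ) := Fintype.piFinset fun _ => Finset.range p
  have hmem : ∀ e ∈ I, mon e ∈ Submodule.span (rootLevel A B ξ n) (I.image mon : Set B) :=
    fun e he => Submodule.subset_span (by simpa using ⟨e, he, rfl⟩)
  have hmul : ∀ i, ∀ v ∈ Submodule.span (rootLevel A B ξ n) (I.image mon : Set B),
      ξ i (n + 1) * v ∈ Submodule.span (rootLevel A B ξ n) (I.image mon : Set B) := by
    intro i v hv
    induction hv using Submodule.span_induction with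
    | zero => simp
    | add x y _ _ hx hy => rw [mul_add]; exact add_mem hx hy
    | smul a x _ hx => rw [mul_smul_comm]; exact Submodule.smul_mem _ a hx
    | mem x hx =>
      obtain ⟨e, he, rfl⟩ : ∃ e ∈ I, mon e = x := by simpa using hx
      have hlt : ∀ j, e j < p := by simpa [I] using he
      have hsplit : ∀ k, mon (Function.update e i k) =
          ξ i (n + 1) ^ k * ∏ j ∈ Finset.univ.erase i, ξ j (n + 1) ^ e j := by
        intro k
        simp only [mon]
        rw [← Finset.mul_prod_erase _ _ (Finset.mem_univ i)]
        simp only [Function.update_self]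
        congr 1
        refine Finset.prod_congr rfl fun j hj => ?_
        rw [Function.update_of_ne (Finset.ne_of_mem_erase hj)]
      have hupd : ∀ k < p, Function.update e i k ∈ I := by
        intro k hk
        simp only [I, Fintype.mem_piFinset, Finset.mem_range]
        intro j
        by_cases hj : j = i
        · subst hj; simpa using hk
        · simpa [Function.update_of_ne hj] using hlt j
      have hself : mon e =
          ξ i (n + 1) ^ e i * ∏ j ∈ Finset.univ.erase i, ξ j (n + 1) ^ e j := by
        simpa using hsplit (e i)
      by_cases hk : e i + 1 < p
      · have : ξ i (n + 1) * mon e = mon (Function.update e i (e i + 1)) := by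
          rw [hself, hsplit]; ring
        rw [this]
        exact hmem _ (hupd _ hk)
      · have hk' : e i + 1 = p := by have := hlt i; omega
        have hmem' : ξ i n ∈ rootLevel A B ξ n := Algebra.subset_adjoin ⟨i, rfl⟩
        have : ξ i (n + 1) * mon e =
            (⟨ξ i n, hmem'⟩ : rootLevel A B ξ n) • mon (Function.update e i 0) := by
          rw [hself, hsplit, Subalgebra.smul_def, smul_eq_mul, ← mul_assoc, ← pow_succ', hk', hξ,
            pow_zero, one_mul]
        rw [this]
        exact Submodule.smul_mem _ _ (hmem _ (hupd _ hp))
  refine ⟨I.image mon, Finset.card_image_le.trans (by simp [I]), ?_, ?_⟩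
  · intro e he
    obtain ⟨e, -, rfl⟩ := Finset.mem_image.1 he
    exact prod_mem fun i _ => pow_mem (Algebra.subset_adjoin (Set.mem_range_self i)) _
  · intro b hb
    have hb' : ∀ v ∈ Submodule.span (rootLevel A B ξ n) (I.image mon : Set B),
        b * v ∈ Submodule.span (rootLevel A B ξ n) (I.image mon : Set B) := by
      induction hb using Algebra.adjoin_induction with
      | mem x hx => obtain ⟨i, rfl⟩ := hx; exact hmul i
      | algebraMap r =>
        intro v hv
        have : algebraMap A B r * v = algebraMap A (rootLevel A B ξ n) r • v := by
          rw [Subalgebra.smul_def, smul_eq_mul]; rfl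
        rw [this]
        exact Submodule.smul_mem _ _ hv
      | add x y _ _ hx hy => intro v hv; rw [add_mul]; exact add_mem (hx v hv) (hy v hv)
      | mul x y _ _ hx hy => intro v hv; rw [mul_assoc]; exact hx _ (hy v hv)
    have h1 : (1 : B) ∈ Submodule.span (rootLevel A B ξ n) (I.image mon : Set B) := by
      have := hmem 0 (by simpa [I] using fun _ => hp)
      simpa [mon] using this
    simpa using hb' 1 h1

end RootLevel

section LevelSpan

variable {A B : Type u} [CommRing A] [CommRing B] [Algebra A B] {p d : ℕ} {ξ : Fin d → ℕ → B}
  {M N : Type u} [AddCommGroup M] [Module A M] [Module B M]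
  [AddCommGroup N] [Module A N] [Module B N]

theorem smul_mem_levelSpan {n : ℕ} {S : Set M} {b : B} {s : M} (hb : b ∈ rootLevel A B ξ n)
    (hs : s ∈ S) : b • s ∈ levelSpan A B ξ n M S :=
  Submodule.subset_span ⟨b, hb, s, hs, rfl⟩

theorem subset_levelSpan (n : ℕ) (S : Set M) : S ⊆ levelSpan A B ξ n M S := fun s hs => by
  simpa using smul_mem_levelSpan (ξ := ξ) (n := n) (one_mem _) hs

theorem levelSpan_le {n : ℕ} {S : Set M} {P : Submodule A M} :
    levelSpan A B ξ n M S ≤ P ↔ ∀ b ∈ rootLevel A B ξ n, ∀ s ∈ S, b • s ∈ P := by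
  refine ⟨fun h b hb s hs => h (smul_mem_levelSpan hb hs), fun h => Submodule.span_le.2 ?_⟩
  rintro _ ⟨b, hb, s, hs, rfl⟩
  exact h b hb s hs

theorem levelSpan_mono_level (hξ : ∀ i n, ξ i (n + 1) ^ p = ξ i n) (S : Set M) :
    Monotone fun n => levelSpan A B ξ n M S := fun _ _ h =>
  levelSpan_le.2 fun _ hb _ hs => smul_mem_levelSpan (rootLevel_mono hξ h hb) hs

variable [IsScalarTower A B M] [IsScalarTower A B N]

theorem smul_levelSpan_mem {n : ℕ} {S : Set M} {b : B} {y : M} (hb : b ∈ rootLevel A B ξ n)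
    (hy : y ∈ levelSpan A B ξ n M S) : b • y ∈ levelSpan A B ξ n M S := by
  have h : levelSpan A B ξ n M S ≤ (levelSpan A B ξ n M S).comap (Algebra.lsmul A A M b) := by
    refine levelSpan_le.2 fun c hc s hs => ?_
    change b • c • s ∈ levelSpan A B ξ n M S
    rw [smul_smul]
    exact smul_mem_levelSpan (mul_mem hb hc) hs
  exact h hy

theorem levelSpan_le_levelSpan {n : ℕ} {S T : Set M} (h : T ⊆ levelSpan A B ξ n M S) :
    levelSpan A B ξ n M T ≤ levelSpan A B ξ n M S :=
  levelSpan_le.2 fun _ hb _ ht => smul_levelSpan_mem hb (h ht)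

theorem map_levelSpan (f : M →ₗ[B] N) (n : ℕ) (S : Set M) :
    (levelSpan A B ξ n M S).map (f.restrictScalars A) = levelSpan A B ξ n N (f '' S) := by
  rw [levelSpan, levelSpan, Submodule.map_span]
  congr 1
  ext y
  constructor
  · rintro ⟨_, ⟨b, hb, s, hs, rfl⟩, rfl⟩
    exact ⟨b, hb, f s, ⟨s, hs, rfl⟩, by simp⟩
  · rintro ⟨b, hb, _, ⟨s, hs, rfl⟩, rfl⟩
    exact ⟨b • s, ⟨b, hb, s, hs, rfl⟩, by simp⟩

/-- Passing from `A_n` to `A_{n+1}` multiplies the length of a subquotient by at most `p ^ d`. -/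
theorem moduleLength_levelSpan_succ_quotient_le (hp : 0 < p)
    (hξ : ∀ i n, ξ i (n + 1) ^ p = ξ i n) (n : ℕ) (S T : Set M) :
    moduleLength A ((levelSpan A B ξ (n + 1) M S).map (levelSpan A B ξ (n + 1) M T).mkQ) ≤
      (p : ENNReal) ^ d *
        moduleLength A ((levelSpan A B ξ n M S).map (levelSpan A B ξ n M T).mkQ) := by
  obtain ⟨E, hcard, hE, hspan⟩ := exists_finset_rootLevel_succ (A := A) hp hξ n
  have hφ : ∀ e ∈ E, levelSpan A B ξ n M T ≤
      (levelSpan A B ξ (n + 1) M T).comap (Algebra.lsmul A A M e) := fun e he y hy =>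
    smul_levelSpan_mem (hE e he) (levelSpan_mono_level hξ T n.le_succ hy)
  let Q := (levelSpan A B ξ n M S).map (levelSpan A B ξ n M T).mkQ
  let R : E → Submodule A (M ⧸ levelSpan A B ξ (n + 1) M T) := fun e =>
    Q.map (Submodule.mapQ _ _ (Algebra.lsmul A A M (e : B)) (hφ e e.2))
  have hle : (levelSpan A B ξ (n + 1) M S).map (levelSpan A B ξ (n + 1) M T).mkQ ≤
      Finset.univ.sup R := by
    rw [Submodule.map_le_iff_le_comap, levelSpan_le]
    intro b hb s hs
    obtain ⟨c, hc⟩ := Submodule.mem_span_finset'.1 (hspan b hb)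
    rw [Submodule.mem_comap, ← hc, Finset.sum_smul, map_sum]
    refine Submodule.sum_mem _ fun e _ => ?_
    refine (Finset.le_sup (f := R) (Finset.mem_univ e)) ?_
    refine ⟨(levelSpan A B ξ n M T).mkQ ((c e : B) • s),
      ⟨_, smul_mem_levelSpan (c e).2 hs, rfl⟩, ?_⟩
    simp [Subalgebra.smul_def, smul_smul, mul_comm]
  calc _ ≤ moduleLength A ↥(Finset.univ.sup R) := moduleLength_mono hle
    _ ≤ ∑ e, moduleLength A (R e) := moduleLength_finset_sup_le _ _
    _ ≤ ∑ _e : E, moduleLength A Q := Finset.sum_le_sum fun e _ => moduleLength_map_le _ _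
    _ = (E.card : ENNReal) * moduleLength A Q := by simp
    _ ≤ _ := by gcongr; exact_mod_cast hcard

theorem antitone_moduleLength_levelSpan_quotient (hp : 0 < p)
    (hξ : ∀ i n, ξ i (n + 1) ^ p = ξ i n) (S T : Set M) :
    Antitone fun n => moduleLength A
      ((levelSpan A B ξ n M S).map (levelSpan A B ξ n M T).mkQ) / (p : ENNReal) ^ (n * d) := by
  refine antitone_nat_of_succ_le fun n => ?_
  have h0 : ∀ k, (p : ENNReal) ^ k ≠ 0 := fun k => pow_ne_zero _ (by exact_mod_cast hp.ne')
  have htop : ∀ k, (p : ENNReal) ^ k ≠ ⊤ := fun k => ENNReal.pow_ne_top (ENNReal.natCast_ne_top p)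
  calc _ ≤ (p : ENNReal) ^ d * moduleLength A
        ((levelSpan A B ξ n M S).map (levelSpan A B ξ n M T).mkQ) /
          ((p : ENNReal) ^ d * (p : ENNReal) ^ (n * d)) := by
        rw [← pow_add, add_comm d, ← Nat.succ_mul]
        gcongr
        exact moduleLength_levelSpan_succ_quotient_le hp hξ n S T
    _ = _ := ENNReal.mul_div_mul_left _ _ (h0 d) (htop d)

theorem antitone_moduleLength_levelSpan (hp : 0 < p)
    (hξ : ∀ i n, ξ i (n + 1) ^ p = ξ i n) (S : Set M) :
    Antitone fun n => moduleLength A (levelSpan A B ξ n M S) / (p : ENNReal) ^ (n * d) := by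
  have h : ∀ n, moduleLength A ((levelSpan A B ξ n M S).map (levelSpan A B ξ n M ∅).mkQ) =
      moduleLength A (levelSpan A B ξ n M S) := fun n => by
    refine moduleLength_map_eq _ ?_ _
    rw [← LinearMap.ker_eq_bot, Submodule.ker_mkQ]
    simp [levelSpan]
  simpa only [h] using
    antitone_moduleLength_levelSpan_quotient (A := A) hp hξ S ∅

theorem exists_forall_subset_levelSpan (hξ : ∀ i n, ξ i (n + 1) ^ p = ξ i n)
    (hunion : ∀ b : B, ∃ n, b ∈ rootLevel A B ξ n) (S : Set M) (T : Finset M)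
    (hT : (T : Set M) ⊆ Submodule.span B S) :
    ∃ m, ∀ n, m ≤ n → (T : Set M) ⊆ levelSpan A B ξ n M S := by
  have key : ∀ t ∈ Submodule.span B S, ∃ m, t ∈ levelSpan A B ξ m M S := by
    intro t ht
    induction ht using Submodule.span_induction with
    | mem x hx => exact ⟨0, subset_levelSpan 0 S hx⟩
    | zero => exact ⟨0, zero_mem _⟩
    | add x y _ _ hx hy =>
      obtain ⟨m, hm⟩ := hx
      obtain ⟨k, hk⟩ := hy
      exact ⟨max m k, add_mem (levelSpan_mono_level hξ S (le_max_left m k) hm)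
        (levelSpan_mono_level hξ S (le_max_right m k) hk)⟩
    | smul b x _ hx =>
      obtain ⟨m, hm⟩ := hx
      obtain ⟨k, hk⟩ := hunion b
      exact ⟨max m k, smul_levelSpan_mem (rootLevel_mono hξ (le_max_right m k) hk)
        (levelSpan_mono_level hξ S (le_max_left m k) hm)⟩
  choose! m hm using key
  exact ⟨T.sup m, fun n hn t ht =>
    levelSpan_mono_level hξ S ((Finset.le_sup (f := m) ht).trans hn) (hm t (hT ht))⟩

theorem normalizedLength_eq_iSup_finset (hp : 0 < p) (hξ : ∀ i n, ξ i (n + 1) ^ p = ξ i n)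
    (hunion : ∀ b : B, ∃ n, b ∈ rootLevel A B ξ n) :
    normalizedLength A B p ξ M = ⨆ S : Finset M, ⨅ n : ℕ,
      moduleLength A ↥(levelSpan A B ξ n M (S : Set M)) / (p : ENNReal) ^ (n * d) := by
  refine le_antisymm (iSup₂_le fun P hP => ?_) (iSup_le fun S => ?_)
  · obtain ⟨S, hS⟩ := hP
    exact (iInf₂_le S hS).trans (le_iSup (fun S : Finset M => ⨅ n : ℕ,
      moduleLength A ↥(levelSpan A B ξ n M (S : Set M)) / (p : ENNReal) ^ (n * d)) S)
  · refine le_trans ?_ (le_iSup₂ (Submodule.span B (S : Set M)) ⟨S, rfl⟩)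
    refine le_iInf₂ fun T hT => le_iInf fun n => ?_
    obtain ⟨m, hm⟩ := exists_forall_subset_levelSpan hξ hunion (T : Set M) S
      (hT ▸ Submodule.subset_span)
    refine (iInf_le _ (max m n)).trans (le_trans ?_
      (antitone_moduleLength_levelSpan hp hξ (T : Set M) (le_max_right m n)))
    dsimp only
    gcongr
    exact moduleLength_mono (levelSpan_le_levelSpan (hm _ (le_max_left m n)))

theorem levelSpan_fg {n : ℕ} [Module.Finite A (rootLevel A B ξ n)] (S : Finset M) :
    (levelSpan A B ξ n M (S : Set M)).FG := by
  have h : levelSpan A B ξ n M (S : Set M) = S.sup fun s =>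
      (⊤ : Submodule A (rootLevel A B ξ n)).map
        (((LinearMap.toSpanSingleton B M s).restrictScalars A).comp
          (rootLevel A B ξ n).val.toLinearMap) := by
    refine le_antisymm (levelSpan_le.2 fun b hb s hs => ?_) (Finset.sup_le fun s hs => ?_)
    · exact Finset.le_sup (f := fun s => (⊤ : Submodule A (rootLevel A B ξ n)).map
        (((LinearMap.toSpanSingleton B M s).restrictScalars A).comp
          (rootLevel A B ξ n).val.toLinearMap)) hs ⟨⟨b, hb⟩, trivial, rfl⟩
    · rintro _ ⟨b, -, rfl⟩
      exact smul_mem_levelSpan b.2 hs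
  rw [h]
  exact Submodule.fg_finset_sup _ _ fun s _ => (Module.Finite.fg_top).map _

end LevelSpan

/-- **Additivity of Faltings' normalized length** (`A` a complete regular local ring with
perfect residue field of characteristic `p > 0`, `B = A_∞,0^{nc} = ∪ₙ A[x₁^{1/pⁿ}, …, x_d^{1/pⁿ}]`
for a fixed regular system of parameters `x`): if `0 → M' → M → M'' → 0` is a short exact
sequence of `m_A`-power-torsion `B`-modules, then `λ_∞(M) = λ_∞(M') + λ_∞(M'')`. -/
theorem normalizedLength_additive
    (A B : Type u) [CommRing A] [IsNoetherianRing A] [IsLocalRing A]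
    [IsAdicComplete (maximalIdeal A) A] (p : ℕ) [Fact p.Prime]
    [CharP (ResidueField A) p] [ExpChar (ResidueField A) p] [PerfectRing (ResidueField A) p]
    [CommRing B] [Algebra A B] (hinj : Function.Injective (algebraMap A B))
    (d : ℕ) (hdim : ringKrullDim A = d) (x : Fin d → A)
    (hx : Ideal.span (Set.range x) = maximalIdeal A)
    (ξ : Fin d → ℕ → B) (hξ0 : ∀ i, ξ i 0 = algebraMap A B (x i))
    (hξ : ∀ i n, ξ i (n + 1) ^ p = ξ i n)
    (hunion : ∀ b : B, ∃ n, b ∈ rootLevel A B ξ n)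
    (hfree : ∀ n, Module.Free A ↥(rootLevel A B ξ n) ∧
      Module.finrank A ↥(rootLevel A B ξ n) = p ^ (n * d))
    (M' M M'' : Type u) [AddCommGroup M'] [Module A M'] [Module B M'] [IsScalarTower A B M']
    [AddCommGroup M] [Module A M] [Module B M] [IsScalarTower A B M]
    [AddCommGroup M''] [Module A M''] [Module B M''] [IsScalarTower A B M'']
    (htor : ∃ k : ℕ, ∀ a ∈ maximalIdeal A ^ k, ∀ m : M, a • m = 0)
    (f : M' →ₗ[B] M) (g : M →ₗ[B] M'')
    (hf : Function.Injective f) (hg : Function.Surjective g)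
    (hfg : LinearMap.range f = LinearMap.ker g) :
    normalizedLength A B p ξ M = normalizedLength A B p ξ M' + normalizedLength A B p ξ M'' := by
  classical
  have hp : 0 < p := (Fact.out : p.Prime).pos
  have hfin : ∀ n, Module.Finite A (rootLevel A B ξ n) := fun n =>
    have := (hfree n).1
    Module.finite_of_finrank_pos (by rw [(hfree n).2]; positivity)
  have hker : LinearMap.range (f.restrictScalars A) = LinearMap.ker (g.restrictScalars A) := by
    ext y; exact SetLike.ext_iff.1 hfg y
  simp only [normalizedLength_eq_iSup_finset hp hξ hunion]
  refine le_antisymm (iSup_le fun S => ?_) (ENNReal.iSup_add_iSup_le fun T' T'' => ?_)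
  · refine le_trans ?_ (add_le_add_right (le_iSup (fun S : Finset M'' => ⨅ n : ℕ,
      moduleLength A ↥(levelSpan A B ξ n M'' (S : Set M'')) / (p : ENNReal) ^ (n * d))
      (S.image g)) _)
    rw [ENNReal.add_iInf]
    refine le_iInf fun m => ?_
    have : IsNoetherian A (levelSpan A B ξ m M (S : Set M)) :=
      isNoetherian_of_fg_of_noetherian _ (levelSpan_fg S)
    let K : Submodule A M := levelSpan A B ξ m M (S : Set M) ⊓ LinearMap.ker (g.restrictScalars A)
    obtain ⟨T, hT⟩ : (K.comap (f.restrictScalars A)).FG := by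
      refine Submodule.fg_of_fg_map_injective (f.restrictScalars A) hf ?_
      exact isNoetherian_submodule.1 this _ ((Submodule.map_comap_le _ K).trans inf_le_left)
    have hTK : (K.comap (f.restrictScalars A)).map (f.restrictScalars A) = K := by
      rw [Submodule.map_comap_eq, hker]; exact inf_eq_right.2 inf_le_right
    have hTm : levelSpan A B ξ m M (f '' T) = K := by
      refine le_antisymm (le_inf (levelSpan_le_levelSpan ?_) ?_) ?_
      · rintro _ ⟨t, ht, rfl⟩
        have : t ∈ K.comap (f.restrictScalars A) := hT ▸ Submodule.subset_span ht
        exact this.1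
      · rw [← map_levelSpan, ← hker]
        exact LinearMap.map_le_range
      · rw [← hTK, ← hT, ← map_levelSpan]
        exact Submodule.map_mono (Submodule.span_le.2 (subset_levelSpan m _))
    have hquot : moduleLength A ((levelSpan A B ξ m M (S : Set M)).map
        (levelSpan A B ξ m M (f '' T)).mkQ) =
          moduleLength A (levelSpan A B ξ m M'' (S.image g : Set M'')) := by
      rw [hTm, moduleLength_map_mkQ_inf_ker, map_levelSpan, Finset.coe_image]
    refine le_trans ?_ (add_le_add_left (le_iSup (fun S : Finset M' => ⨅ n : ℕ,
      moduleLength A ↥(levelSpan A B ξ n M' (S : Set M')) / (p : ENNReal) ^ (n * d)) T) _)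
    rw [ENNReal.iInf_add]
    refine le_iInf fun n => ?_
    refine (iInf_le _ (max m n)).trans ?_
    have h1 := antitone_moduleLength_levelSpan (A := A) hp hξ (T : Set M') (le_max_right m n)
    have h2 := antitone_moduleLength_levelSpan_quotient (A := A) hp hξ (S : Set M) (f '' T)
      (le_max_left m n)
    dsimp only at h1 h2
    rw [hquot] at h2
    refine le_trans ?_ (add_le_add h1 h2)
    rw [← ENNReal.add_div]
    gcongr
    rw [moduleLength_eq_inf_ker_add_map (levelSpan A B ξ (max m n) M (f '' T)).mkQ
      (levelSpan A B ξ (max m n) M (S : Set M)), Submodule.ker_mkQ]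
    gcongr
    rw [← moduleLength_map_eq (f.restrictScalars A) hf, map_levelSpan]
    exact moduleLength_mono inf_le_right
  · obtain ⟨T, hT⟩ : ∃ T : Finset M, T.image g = T'' := by
      refine ⟨T''.image (Function.surjInv hg), ?_⟩
      rw [Finset.image_image, (Function.rightInverse_surjInv hg).comp_eq_id, Finset.image_id]
    refine le_trans ?_ (le_iSup (fun S : Finset M => ⨅ n : ℕ,
      moduleLength A ↥(levelSpan A B ξ n M (S : Set M)) / (p : ENNReal) ^ (n * d))
      (T'.image f ∪ T))
    refine le_iInf fun n => (add_le_add (iInf_le _ n) (iInf_le _ n)).trans ?_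
    rw [← ENNReal.add_div]
    gcongr
    rw [moduleLength_eq_inf_ker_add_map (g.restrictScalars A)
      (levelSpan A B ξ n M ↑(T'.image f ∪ T)), map_levelSpan,
      ← moduleLength_map_eq (f.restrictScalars A) hf, map_levelSpan]
    refine add_le_add (moduleLength_mono (le_inf (levelSpan_le_levelSpan ?_) ?_))
      (moduleLength_mono (levelSpan_le_levelSpan ?_))
    · refine Set.Subset.trans ?_ (subset_levelSpan n _)
      simp
    · rw [← map_levelSpan, ← hker]
      exact LinearMap.map_le_range
    · refine Set.Subset.trans ?_ (subset_levelSpan n _)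
      rw [← hT]
      simp [Set.image_union]
end

section
/- Let (R, m) ⊆ (S, n) be a finite extension of Noetherian local domains and suppose Φ ∈ Hom_R(S, R) generates Hom_R(S, R) as an S-module, Φ is surjective, and Φ(n) ⊆ m. Then for any R-algebra T and x ∈ T, if the R-module map R → T sending 1 to x is pure, then the S-module map S → T sending 1 to x is pure; consequently the non-purity locus {x ∈ T : S → T, 1 ↦ x, is not pure} is contained in {x ∈ T : R → T, 1 ↦ x, is not pure}, and under the above hypotheses these two sets are equal. -/
universe u v

/-- A map of `R`-modules `N → M` is *pure* if after tensoring with any `R`-module `K`,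
the induced map `N ⊗ K → M ⊗ K` is injective. -/
def IsPureMap {R : Type u} [CommRing R] {N M : Type v} [AddCommGroup N] [Module R N]
    [AddCommGroup M] [Module R M] (f : N →ₗ[R] M) : Prop :=
  ∀ (K : Type v) [AddCommGroup K] [Module R K], Function.Injective (LinearMap.rTensor K f)

open TensorProduct in
/-- If `R → M`, `1 ↦ x` is pure, then it splits on every finitely generated submodule
of `M` containing `x`. -/
theorem IsPureMap.exists_retraction_of_fg {R M : Type u} [CommRing R] [IsNoetherianRing R]
    [AddCommGroup M] [Module R M] {x : M} (h : IsPureMap (LinearMap.toSpanSingleton R M x))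
    {N : Submodule R M} (hN : N.FG) (hx : x ∈ N) : ∃ ρ : N →ₗ[R] R, ρ ⟨x, hx⟩ = 1 := by
  have : Module.Finite R N := Module.Finite.iff_fg.mpr hN
  have : Module.FinitePresentation R N := Module.finitePresentation_of_finite R N
  obtain ⟨n, m, f, g, hf, hfg⟩ := Module.FinitePresentation.exists_fin' R N
  obtain ⟨v, hv⟩ := hf ⟨x, hx⟩
  have hsum (w : Fin n → R) : f w = ∑ i, w i • f (Pi.single i 1) := by
    simp_rw [← map_smul, ← map_sum]
    congr 1
    ext
    simp [Finset.sum_apply, Pi.single_apply]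
  let D : Module.Dual R (Fin n → R) →ₗ[R] Module.Dual R (Fin m → R) × R :=
    g.dualMap.prod (Module.Dual.eval R _ v)
  let q := (LinearMap.range D).mkQ
  have hq (i : Fin n) : q (0, v i) =
      ∑ j, (-(g (Pi.single j 1) i)) • q (LinearMap.proj j, 0) := by
    rw [← sub_eq_zero]
    simp only [← map_smul, ← map_sum, ← map_sub]
    refine (Submodule.Quotient.mk_eq_zero _).mpr ⟨LinearMap.proj i, ?_⟩
    ext j <;> simp [D, Prod.fst_sum, Prod.snd_sum, Pi.single_apply]
  have hvan : VanishesTrivially R (fun i ↦ (f (Pi.single i 1) : M)) (fun i ↦ q (0, v i)) := by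
    refine .of_fintype _ _ hq fun j ↦ ?_
    have h0 : f (g (Pi.single j 1)) = 0 := hfg.apply_apply_eq_zero _
    rw [hsum] at h0
    simpa using congrArg Subtype.val h0
  have hxsum : ∑ i, v i • (f (Pi.single i 1) : M) = x := by
    rw [hsum] at hv
    simpa using congrArg Subtype.val hv
  have hzero : x ⊗ₜ[R] q (0, 1) = 0 := by
    rw [← hxsum, sum_tmul, ← sum_tmul_eq_zero_of_vanishesTrivially R hvan]
    refine Finset.sum_congr rfl fun i _ ↦ ?_
    rw [smul_tmul, ← map_smul]
    simp
  have hq1 : q (0, 1) = 0 := by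
    have h1 : (1 : R) ⊗ₜ[R] q (0, 1) = 0 := h _ (by simpa using hzero)
    simpa using congrArg (TensorProduct.lid R _) h1
  obtain ⟨ρ, hρ⟩ := (Submodule.Quotient.mk_eq_zero _).mp hq1
  have hρg : ρ ∘ₗ g = 0 := congrArg Prod.fst hρ
  have hρv : ρ v = 1 := congrArg Prod.snd hρ
  have hker : LinearMap.ker f ≤ LinearMap.ker ρ := fun y hy ↦ by
    obtain ⟨z, rfl⟩ := (hfg y).mp hy
    exact LinearMap.congr_fun hρg z
  refine ⟨(LinearMap.ker f).liftQ ρ hker ∘ₗ (f.quotKerEquivOfSurjective hf).symm, ?_⟩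
  have he : (f.quotKerEquivOfSurjective hf).symm ⟨x, hx⟩ = Submodule.Quotient.mk v := by
    rw [LinearEquiv.symm_apply_eq, ← hv]
    rfl
  simpa [he] using hρv

/-- If `R → M`, `1 ↦ x` splits on every finitely generated submodule of `M` containing `x`,
then it is pure. -/
theorem isPureMap_of_forall_fg_exists_retraction {R M : Type u} [CommRing R]
    [AddCommGroup M] [Module R M] {x : M}
    (h : ∀ N : Submodule R M, N.FG → ∀ hx : x ∈ N, ∃ ρ : N →ₗ[R] R, ρ ⟨x, hx⟩ = 1) :
    IsPureMap (LinearMap.toSpanSingleton R M x) := by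
  intro K _ _
  rw [injective_iff_map_eq_zero]
  intro z hz
  obtain ⟨k, rfl⟩ := (TensorProduct.lid R K).symm.surjective z
  let y : Submodule.span R {x} := ⟨x, Submodule.mem_span_singleton_self x⟩
  have hy : LinearMap.rTensor K (Submodule.span R {x}).subtype (y ⊗ₜ[R] k) =
      LinearMap.rTensor K (Submodule.span R {x}).subtype 0 := by
    simpa [y] using hz
  obtain ⟨N, hN, hle, heq⟩ :=
    (Submodule.fg_span_singleton x).exists_rTensor_fg_inclusion_eq hy
  obtain ⟨ρ, hρ⟩ := h N hN (hle y.2)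
  have hk := congrArg (fun t ↦ TensorProduct.lid R K (LinearMap.rTensor K ρ t)) heq
  have hρy : ρ (Submodule.inclusion hle y) = 1 := hρ
  have hk0 : k = 0 := by simpa [hρy] using hk
  simp [hk0]

/-- A nonzero `R`-linear map `Φ : S → R` from an integral extension of domains is free
under premultiplication. -/
theorem eq_zero_of_forall_apply_mul_eq_zero {R S : Type*} [CommRing R] [IsDomain R] [CommRing S]
    [IsDomain S] [Algebra R S] [Algebra.IsIntegral R S] {Φ : S →ₗ[R] R} (hΦ : Φ ≠ 0) {a : S}
    (ha : ∀ t, Φ (a * t) = 0) : a = 0 := by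
  by_contra hne
  obtain ⟨r, hr, hr0⟩ := Submodule.exists_mem_ne_zero_of_ne_bot
    (Ideal.comap_ne_bot_of_integral_mem (R := R) hne (Ideal.mem_span_singleton_self a)
      (Algebra.IsIntegral.isIntegral a))
  obtain ⟨b, hb⟩ := Ideal.mem_span_singleton'.mp (Ideal.mem_comap.mp hr)
  refine hΦ (LinearMap.ext fun t ↦ ?_)
  have h : r * Φ t = 0 := by
    rw [← smul_eq_mul, ← map_smul, Algebra.smul_def, ← hb, mul_comm b, mul_assoc, ha]
  exact (mul_eq_zero.mp h).resolve_left hr0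

/-- If `Φ` freely generates `Hom_R(S, R)` over `S`, every `R`-linear map `M → R` on an `S`-module
factors as `Φ` after an `S`-linear map `M → S`. -/
theorem exists_linearMap_comp_eq {R S M : Type*} [CommRing R] [CommRing S] [Algebra R S]
    [AddCommGroup M] [Module R M] [Module S M] [IsScalarTower R S M] (Φ : S →ₗ[R] R)
    (hgen : ∀ ψ : S →ₗ[R] R, ∃ s : S, ∀ t : S, ψ t = Φ (s * t))
    (hfree : ∀ a : S, (∀ t, Φ (a * t) = 0) → a = 0) (ρ : M →ₗ[R] R) :
    ∃ g : M →ₗ[S] S, ∀ y, ρ y = Φ (g y) := by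
  have hex (y : M) : ∃ s : S, ∀ t : S, ρ (t • y) = Φ (s * t) :=
    hgen (ρ ∘ₗ (LinearMap.toSpanSingleton S M y).restrictScalars R)
  choose g hg using hex
  have huniq {a b : S} (hab : ∀ t, Φ (a * t) = Φ (b * t)) : a = b :=
    sub_eq_zero.mp <| hfree _ fun t ↦ by rw [sub_mul, map_sub, hab, sub_self]
  refine ⟨⟨⟨g, fun y z ↦ huniq fun t ↦ ?_⟩, fun s y ↦ huniq fun t ↦ ?_⟩, fun y ↦ ?_⟩
  · rw [add_mul, map_add, ← hg, ← hg, ← hg, smul_add, map_add]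
  · rw [← hg, smul_smul, hg, RingHom.id_apply, smul_eq_mul, ← mul_assoc, mul_comm s,
      mul_right_comm]
  · simpa using hg y 1

/-- Let `(R, m) ⊆ (S, n)` be a finite extension of Noetherian local domains and suppose
`Φ ∈ Hom_R(S, R)` generates `Hom_R(S, R)` as an `S`-module (via premultiplication), is
surjective, and satisfies `Φ(n) ⊆ m`.  Then for any `S`-algebra `T` and `x ∈ T`, if the
`R`-module map `R → T`, `1 ↦ x` is pure then so is the `S`-module map `S → T`, `1 ↦ x`;
consequently the non-purity locus over `S` is contained in the non-purity locus over `R`,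
and in fact the two loci coincide. -/
theorem nonpure_locus_transfer {R S : Type u} [CommRing R] [IsDomain R] [IsNoetherianRing R]
    [IsLocalRing R] [CommRing S] [IsDomain S] [IsNoetherianRing S] [IsLocalRing S]
    [Algebra R S] [Module.Finite R S] (hext : Function.Injective (algebraMap R S))
    (Φ : S →ₗ[R] R)
    (hgen : ∀ ψ : S →ₗ[R] R, ∃ s : S, ∀ t : S, ψ t = Φ (s * t))
    (hsurj : Function.Surjective Φ)
    (hmax : ∀ s ∈ IsLocalRing.maximalIdeal S, Φ s ∈ IsLocalRing.maximalIdeal R)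
    (T : Type u) [CommRing T] [Algebra R T] [Algebra S T] [IsScalarTower R S T] :
    (∀ x : T, IsPureMap (LinearMap.toSpanSingleton R T x) →
        IsPureMap (LinearMap.toSpanSingleton S T x)) ∧
      {x : T | ¬ IsPureMap (LinearMap.toSpanSingleton S T x)} =
        {x : T | ¬ IsPureMap (LinearMap.toSpanSingleton R T x)} := by
  have hΦ : Φ ≠ 0 := fun h0 ↦ by
    obtain ⟨s, hs⟩ := hsurj 1
    simp [h0] at hs
  have hRS (x : T) (h : IsPureMap (LinearMap.toSpanSingleton R T x)) :
      IsPureMap (LinearMap.toSpanSingleton S T x) := by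
    refine isPureMap_of_forall_fg_exists_retraction fun N hN hx ↦ ?_
    have : Module.Finite S N := Module.Finite.iff_fg.mpr hN
    have : Module.Finite R N := Module.Finite.trans S N
    obtain ⟨ρ, hρ⟩ := h.exists_retraction_of_fg (N := N.restrictScalars R)
      (Module.Finite.iff_fg.mp this) hx
    let ρ' : N →ₗ[R] R := ρ
    obtain ⟨g, hg⟩ := exists_linearMap_comp_eq Φ hgen
      (fun a ↦ eq_zero_of_forall_apply_mul_eq_zero hΦ) ρ'
    have hunit : IsUnit (g ⟨x, hx⟩) := by
      by_contra hnu
      have hm := hmax _ ((IsLocalRing.mem_maximalIdeal _).mpr hnu)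
      rw [← hg, show ρ' ⟨x, hx⟩ = 1 from hρ] at hm
      exact (IsLocalRing.maximalIdeal.isMaximal R).ne_top
        ((Ideal.eq_top_iff_one _).mpr hm)
    obtain ⟨u, hu⟩ := hunit.exists_left_inv
    exact ⟨u • g, hu⟩
  have hSR (x : T) (h : IsPureMap (LinearMap.toSpanSingleton S T x)) :
      IsPureMap (LinearMap.toSpanSingleton R T x) := by
    refine isPureMap_of_forall_fg_exists_retraction fun N hN hx ↦ ?_
    obtain ⟨F, rfl⟩ := hN
    have hle : Submodule.span R (F : Set T) ≤
        (Submodule.span S (F : Set T)).restrictScalars R := Submodule.span_le_restrictScalars R S _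
    obtain ⟨g, hg⟩ := h.exists_retraction_of_fg ⟨F, rfl⟩ (hle hx)
    obtain ⟨u, hu⟩ := hsurj 1
    refine ⟨Φ ∘ₗ ((u • g).restrictScalars R) ∘ₗ Submodule.inclusion hle, ?_⟩
    change Φ (u * g ⟨x, hle hx⟩) = 1
    rw [hg, mul_one, hu]
  refine ⟨hRS, Set.ext fun x ↦ not_congr ⟨hSR x, hRS x⟩⟩
end

section
/- Let (R, m) be a Noetherian local ring, (I_t) a descending chain of m-primary ideals cofinal with powers of m such that each R/I_t is Gorenstein with socle generator u_t, and M an R-module. Then R → M (sending 1 ↦ x) is pure if and only if for every t, the image of u_t·x in M/I_t M is nonzero whenever x generates a pure map; equivalently, R → M is pure if and only if R/I_t → M/I_t M is injective for all t. -/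
universe u v

open IsLocalRing

section GorensteinArtinian

variable {A : Type*} [CommRing A]

theorem Module.length_le_add_of_exact {N P Q : Type*} [AddCommGroup N] [AddCommGroup P]
    [AddCommGroup Q] [Module A N] [Module A P] [Module A Q] {f : N →ₗ[A] P} {g : P →ₗ[A] Q}
    (hf : Function.Injective f) (H : Function.Exact f g) :
    Module.length A P ≤ Module.length A N + Module.length A Q := by
  rw [Module.length_eq_add_of_exact f g.rangeRestrict hf g.surjective_rangeRestrict
    (by rw [LinearMap.exact_iff] at H ⊢; rw [LinearMap.ker_rangeRestrict, H])]
  gcongr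
  exact Module.length_le_of_injective _ (LinearMap.range g).injective_subtype

/-- The contravariant functor `Hom(-, P)` is left exact, so lengths are subadditive. -/
theorem Module.length_hom_le_add {N : Type*} [AddCommGroup N] [Module A N] (Q : Submodule A N)
    (P : Type*) [AddCommGroup P] [Module A P] :
    Module.length A (N →ₗ[A] P) ≤
      Module.length A ((N ⧸ Q) →ₗ[A] P) + Module.length A (Q →ₗ[A] P) :=
  Module.length_le_add_of_exact
    (LinearMap.lcomp_injective_of_surjective Q.mkQ Q.mkQ_surjective)
    (LinearMap.exact_lcomp_of_exact_of_surjective P (LinearMap.exact_subtype_mkQ Q)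
      Q.mkQ_surjective)

variable [IsLocalRing A] {u : A}

theorem Module.length_hom_le_one_of_socle (hu : ∀ a ∈ maximalIdeal A, a * u = 0)
    (hsocle : ∀ b : A, (∀ a ∈ maximalIdeal A, a * b = 0) → b ∈ Ideal.span {u})
    (S : Type*) [AddCommGroup S] [Module A S] [IsSimpleModule A S] :
    Module.length A (S →ₗ[A] A) ≤ 1 := by
  obtain ⟨m, hm, ⟨e⟩⟩ := isSimpleModule_iff_quot_maximal.mp ‹IsSimpleModule A S›
  obtain rfl := eq_maximalIdeal hm
  let ev : (S →ₗ[A] A) →ₗ[A] A := LinearMap.applyₗ (e.symm 1)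
  have hev : Function.Injective ev := by
    intro f g hfg
    have : f ∘ₗ e.symm.toLinearMap = g ∘ₗ e.symm.toLinearMap := by
      ext
      exact hfg
    ext s
    simpa using LinearMap.congr_fun this (e s)
  let ψ : (A ⧸ maximalIdeal A) →ₗ[A] A :=
    (maximalIdeal A).liftQ (LinearMap.toSpanSingleton A A u) fun a ha ↦ by simpa using hu a ha
  have hle : LinearMap.range ev ≤ LinearMap.range ψ := by
    rintro _ ⟨f, rfl⟩
    have hmem : ev f ∈ Ideal.span {u} := hsocle _ fun a ha ↦ by
      have : a • e.symm 1 = 0 := by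
        rw [← map_smul, Algebra.smul_def, mul_one, Ideal.Quotient.algebraMap_eq,
          Ideal.Quotient.eq_zero_iff_mem.mpr ha, map_zero]
      simpa [ev] using! (map_smul f a (e.symm 1)).symm.trans (by rw [this, map_zero])
    obtain ⟨c, hc⟩ := Ideal.mem_span_singleton'.mp hmem
    exact ⟨Submodule.Quotient.mk c, hc⟩
  calc Module.length A (S →ₗ[A] A)
      = Module.length A (LinearMap.range ev) := (LinearEquiv.ofInjective ev hev).length_eq
    _ ≤ Module.length A (LinearMap.range ψ) :=
      Module.length_le_of_injective _ (Submodule.inclusion_injective hle)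
    _ ≤ Module.length A (A ⧸ maximalIdeal A) :=
      Module.length_le_of_surjective _ ψ.surjective_rangeRestrict
    _ = Module.length A S := e.length_eq.symm
    _ = 1 := Module.length_eq_one A S

theorem Module.length_hom_le_of_socle (hu : ∀ a ∈ maximalIdeal A, a * u = 0)
    (hsocle : ∀ b : A, (∀ a ∈ maximalIdeal A, a * b = 0) → b ∈ Ideal.span {u})
    {N : Type*} [AddCommGroup N] [Module A N] (hN : IsFiniteLength A N) :
    Module.length A (N →ₗ[A] A) ≤ Module.length A N := by
  induction hN with
  | of_subsingleton => simp
  | @of_simple_quotient N _ _ Q _ _ ih =>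
    calc Module.length A (N →ₗ[A] A)
        ≤ Module.length A ((N ⧸ Q) →ₗ[A] A) + Module.length A (Q →ₗ[A] A) :=
          Module.length_hom_le_add Q A
      _ ≤ Module.length A (N ⧸ Q) + Module.length A Q := by
          rw [Module.length_eq_one A (N ⧸ Q)]
          exact add_le_add (Module.length_hom_le_one_of_socle hu hsocle _) ih
      _ = Module.length A N := by
          rw [add_comm]
          exact (Module.length_eq_add_of_exact _ _ Q.injective_subtype Q.mkQ_surjective
            (LinearMap.exact_subtype_mkQ Q)).symm

theorem Module.length_le_length_hom_of_socle [IsArtinianRing A]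
    (hu : ∀ a ∈ maximalIdeal A, a * u = 0)
    (hsocle : ∀ b : A, (∀ a ∈ maximalIdeal A, a * b = 0) → b ∈ Ideal.span {u})
    (N : Type*) [AddCommGroup N] [Module A N] [Module.Finite A N] :
    Module.length A N ≤ Module.length A (N →ₗ[A] A) := by
  obtain ⟨n, p, hp⟩ := Module.Finite.exists_fin' A N
  have hker : Module.length A (LinearMap.ker p) ≠ ⊤ := Module.length_ne_top
  refine (ENat.add_le_add_iff_left hker).mp ?_
  calc Module.length A (LinearMap.ker p) + Module.length A N
      = Module.length A (Fin n → A) :=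
        (Module.length_eq_add_of_exact _ p (LinearMap.ker p).injective_subtype hp
          (LinearMap.exact_subtype_ker_map p)).symm
    _ = Module.length A ((Fin n → A) →ₗ[A] A) := (Module.piEquiv (Fin n) A A).length_eq
    _ ≤ Module.length A (N →ₗ[A] A) + Module.length A (LinearMap.ker p →ₗ[A] A) :=
        Module.length_le_add_of_exact
          (LinearMap.lcomp_injective_of_surjective p hp)
          (LinearMap.exact_lcomp_of_exact_of_surjective A (LinearMap.exact_subtype_ker_map p) hp)
    _ ≤ Module.length A (LinearMap.ker p) + Module.length A (N →ₗ[A] A) := by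
        rw [add_comm]
        gcongr
        exact Module.length_hom_le_of_socle hu hsocle (Module.length_ne_top_iff.mp hker)

/-- An Artinian local ring with simple socle cogenerates its finitely generated modules. -/
theorem exists_linearMap_apply_ne_zero_of_socle [IsArtinianRing A]
    (hu : ∀ a ∈ maximalIdeal A, a * u = 0)
    (hsocle : ∀ b : A, (∀ a ∈ maximalIdeal A, a * b = 0) → b ∈ Ideal.span {u})
    {N : Type*} [AddCommGroup N] [Module A N] [Module.Finite A N] {k : N} (hk : k ≠ 0) :
    ∃ φ : N →ₗ[A] A, φ k ≠ 0 := by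
  by_contra! h
  let Q : Submodule A N := Submodule.span A {k}
  have hQ : Q ≠ ⊥ := by simpa [Q] using hk
  have hsurj : Function.Surjective (LinearMap.lcomp A A Q.mkQ) := fun φ ↦
    have hφ : Q ≤ LinearMap.ker φ := (Submodule.span_singleton_le_iff_mem k _).mpr (h φ)
    ⟨Q.liftQ φ hφ, Q.liftQ_mkQ φ hφ⟩
  have hfin : IsFiniteLength A (N ⧸ Q) := Module.length_ne_top_iff.mp Module.length_ne_top
  refine (Submodule.length_quotient_lt Q hQ).not_ge ?_
  calc Module.length A N
      ≤ Module.length A (N →ₗ[A] A) := Module.length_le_length_hom_of_socle hu hsocle N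
    _ ≤ Module.length A ((N ⧸ Q) →ₗ[A] A) := Module.length_le_of_surjective _ hsurj
    _ ≤ Module.length A (N ⧸ Q) := Module.length_hom_le_of_socle hu hsocle hfin

end GorensteinArtinian

section LocalRing

variable {R : Type*} [CommRing R] [IsLocalRing R] {I : Ideal R} {u : R}

theorem exists_linearMap_quotient_apply_ne_zero [IsNoetherianRing R]
    (hprimary : ∃ k : ℕ, maximalIdeal R ^ k ≤ I) (hu : u ∉ I)
    (hsocle : I.colon (maximalIdeal R) = I ⊔ Ideal.span {u})
    {N : Type*} [AddCommGroup N] [Module R N] [Module.Finite R N] {k : N}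
    (hk : k ∉ I • (⊤ : Submodule R N)) :
    ∃ φ : N →ₗ[R] R ⧸ I, φ k ≠ 0 := by
  have hI : I ≠ ⊤ := fun h ↦ hu (h ▸ Submodule.mem_top)
  have : Nontrivial (R ⧸ I) := Ideal.Quotient.nontrivial_iff.mpr hI
  have hmk : Function.Surjective (Ideal.Quotient.mk I) := Ideal.Quotient.mk_surjective
  have : IsLocalRing (R ⧸ I) := .of_surjective' _ hmk
  have hmax : maximalIdeal (R ⧸ I) = (maximalIdeal R).map (Ideal.Quotient.mk I) :=
    (map_maximalIdeal_of_surjective _ hmk).symm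
  have : IsArtinianRing (R ⧸ I) := by
    rw [isArtinianRing_iff_isNilpotent_maximalIdeal]
    obtain ⟨n, hn⟩ := hprimary
    refine ⟨n, ?_⟩
    rw [hmax, ← Ideal.map_pow, Ideal.zero_eq_bot, Ideal.map_eq_bot_iff_le_ker, Ideal.mk_ker]
    exact hn
  have hmem (a : R) (ha : a ∈ maximalIdeal R) :
      Ideal.Quotient.mk I a ∈ maximalIdeal (R ⧸ I) := hmax ▸ Ideal.mem_map_of_mem _ ha
  obtain ⟨φ, hφ⟩ := exists_linearMap_apply_ne_zero_of_socle (A := R ⧸ I)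
    (u := Ideal.Quotient.mk I u) (N := N ⧸ I • (⊤ : Submodule R N))
    (k := Submodule.Quotient.mk k)
    (fun a ha ↦ by
      rw [hmax] at ha
      obtain ⟨a, ham, rfl⟩ := (Ideal.mem_map_iff_of_surjective _ hmk).mp ha
      rw [← map_mul, Ideal.Quotient.eq_zero_iff_mem, mul_comm]
      have : u ∈ I.colon (maximalIdeal R) :=
        hsocle ▸ Ideal.mem_sup_right (Ideal.mem_span_singleton_self u)
      exact Submodule.mem_colon.mp this a ham)
    (fun b hb ↦ by
      obtain ⟨b, rfl⟩ := hmk b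
      have : b ∈ I.colon (maximalIdeal R) := Submodule.mem_colon.mpr fun a ha ↦ by
        have := hb _ (hmem a ha)
        rwa [← map_mul, Ideal.Quotient.eq_zero_iff_mem, mul_comm] at this
      rw [hsocle, Submodule.mem_sup] at this
      obtain ⟨y, hy, z, hz, rfl⟩ := this
      rw [map_add, Ideal.Quotient.eq_zero_iff_mem.mpr hy, zero_add]
      simpa [Ideal.map_span] using Ideal.mem_map_of_mem (Ideal.Quotient.mk I) hz)
    (by rwa [Ne, Submodule.Quotient.mk_eq_zero])
  exact ⟨φ.restrictScalars R ∘ₗ (I • (⊤ : Submodule R N)).mkQ, hφ⟩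

/-- Every ideal strictly containing `I` contains the socle generator of `R ⧸ I`. -/
theorem exists_mul_sub_mem_of_notMem (hprimary : ∃ k : ℕ, maximalIdeal R ^ k ≤ I)
    (hsocle : I.colon (maximalIdeal R) = I ⊔ Ideal.span {u}) {r : R} (hr : r ∉ I) :
    ∃ s : R, s * r - u ∈ I := by
  classical
  have hex : ∃ n : ℕ, ∀ a ∈ maximalIdeal R ^ n, a * r ∈ I :=
    hprimary.imp fun n hn a ha ↦ I.mul_mem_right r (hn ha)
  have hspec := Nat.find_spec hex
  have hmin (m : ℕ) (hm : m < Nat.find hex) := Nat.find_min hex hm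
  generalize Nat.find hex = n at hspec hmin
  obtain - | n := n
  · exact absurd (by simpa using hspec 1 (by simp)) hr
  obtain ⟨s, hs, hsr⟩ : ∃ s ∈ maximalIdeal R ^ n, s * r ∉ I := by
    simpa using hmin n n.lt_succ_self
  have hcolon : s * r ∈ I.colon (maximalIdeal R) := Submodule.mem_colon.mpr fun a ha ↦ by
    have := hspec (s * a) (by rw [pow_succ]; exact Ideal.mul_mem_mul hs ha)
    rwa [smul_eq_mul, mul_right_comm]
  rw [hsocle, Submodule.mem_sup] at hcolon
  obtain ⟨y, hy, z, hz, hyz⟩ := hcolon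
  obtain ⟨c, rfl⟩ := Ideal.mem_span_singleton'.mp hz
  have hc : IsUnit c := by
    by_contra hc
    have hcm : c ∈ maximalIdeal R := (mem_maximalIdeal c).mpr hc
    have hu : u ∈ I.colon (maximalIdeal R) :=
      hsocle ▸ Ideal.mem_sup_right (Ideal.mem_span_singleton_self u)
    have hcu : u * c ∈ I := Submodule.mem_colon.mp hu c hcm
    exact hsr (hyz ▸ I.add_mem hy (mul_comm c u ▸ hcu))
  obtain ⟨c, rfl⟩ := hc
  refine ⟨↑c⁻¹ * s, ?_⟩
  have : (↑c⁻¹ : R) * s * r - u = ↑c⁻¹ * y := by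
    rw [mul_assoc, ← hyz, mul_add, ← mul_assoc (↑c⁻¹ : R) ↑c u, Units.inv_mul]
    ring
  rw [this]
  exact I.mul_mem_left _ hy

end LocalRing

section Purity

open TensorProduct

theorem isPureMap_toSpanSingleton_iff {R : Type u} {M : Type u} [CommRing R] [AddCommGroup M]
    [Module R M] {x : M} :
    IsPureMap (LinearMap.toSpanSingleton R M x) ↔
      ∀ (K : Type u) [AddCommGroup K] [Module R K] (k : K), x ⊗ₜ[R] k = 0 → k = 0 := by
  refine forall₃_congr fun K _ _ ↦ ?_
  have hinj : Function.Injective ((LinearMap.toSpanSingleton R M x).rTensor K) ↔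
      Function.Injective (TensorProduct.mk R M K x) := by
    have : (LinearMap.toSpanSingleton R M x).rTensor K ∘ₗ
        (TensorProduct.lid R K).symm.toLinearMap = TensorProduct.mk R M K x := by
      ext k
      simp
    rw [← this, LinearMap.coe_comp]
    exact ((TensorProduct.lid R K).symm.toEquiv.injective_comp _).symm
  rw [hinj, injective_iff_map_eq_zero]
  rfl

/-- A tensor `x ⊗ k` that vanishes already vanishes over a finitely generated submodule. -/
theorem TensorProduct.exists_fg_tmul_eq_zero {R M K : Type*} [CommRing R] [AddCommGroup M]
    [Module R M] [AddCommGroup K] [Module R K] {x : M} {k : K} (h : x ⊗ₜ[R] k = 0) :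
    ∃ (N : Submodule R K) (hk : k ∈ N), N.FG ∧ x ⊗ₜ[R] (⟨k, hk⟩ : N) = 0 := by
  have hk : k ∈ Submodule.span R {k} := Submodule.mem_span_singleton_self k
  obtain ⟨N, hle, hN, h0⟩ := TensorProduct.eq_zero_of_fg_of_subtype_eq_zero
    (Submodule.fg_span_singleton k) (t := (⟨k, hk⟩ : Submodule.span R {k}) ⊗ₜ[R] x)
    (by simpa using congrArg (TensorProduct.comm R M K) h)
  exact ⟨N, hle hk, hN, by simpa using! congrArg (TensorProduct.comm R N M) h0⟩

theorem smul_mem_smul_top_iff_tmul_eq_zero {R M : Type*} [CommRing R] [AddCommGroup M]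
    [Module R M] (I : Ideal R) (r : R) (x : M) :
    r • x ∈ I • (⊤ : Submodule R M) ↔ x ⊗ₜ[R] (Ideal.Quotient.mk I r) = 0 := by
  rw [← (tensorQuotEquivQuotSMul M I).map_eq_zero_iff, tensorQuotEquivQuotSMul_tmul_mk,
    Submodule.Quotient.mk_eq_zero]

end Purity

/-- **Purity criterion over approximately Gorenstein rings.**  Let `(R, m)` be a Noetherian
local ring, `(I_t)` a descending chain of `m`-primary ideals cofinal with the powers of `m`,
with each `R/I_t` Gorenstein with socle generator `u_t`, and `M` an `R`-module.  Then the map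
`R → M`, `1 ↦ x` is pure if and only if for every `t` the image of `u_t·x` in `M/I_t M` is
nonzero; equivalently, if and only if the induced map `R/I_t → M/I_t M` is injective for
every `t` (stated elementwise: `r • x ∈ I_t M → r ∈ I_t`). -/
theorem isPureMap_iff_socle_image_nonzero {R : Type u} [CommRing R] [IsNoetherianRing R]
    [IsLocalRing R] (I : ℕ → Ideal R) (u : ℕ → R) (hI : Antitone I)
    (hprimary : ∀ t, ∃ k : ℕ, IsLocalRing.maximalIdeal R ^ k ≤ I t)
    (hcofinal : ∀ n : ℕ, ∃ t, I t ≤ IsLocalRing.maximalIdeal R ^ n)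
    (hGor : ∀ t, u t ∉ I t ∧
      (I t).colon (IsLocalRing.maximalIdeal R) = I t ⊔ Ideal.span {u t})
    (M : Type u) [AddCommGroup M] [Module R M] (x : M) :
    (IsPureMap (LinearMap.toSpanSingleton R M x) ↔
        ∀ t, u t • x ∉ I t • (⊤ : Submodule R M)) ∧
      (IsPureMap (LinearMap.toSpanSingleton R M x) ↔
        ∀ t, ∀ r : R, r • x ∈ I t • (⊤ : Submodule R M) → r ∈ I t) := by
  have hpure : IsPureMap (LinearMap.toSpanSingleton R M x) ↔
      ∀ t, ∀ r : R, r • x ∈ I t • (⊤ : Submodule R M) → r ∈ I t := by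
    rw [isPureMap_toSpanSingleton_iff]
    refine ⟨fun h t r hr ↦ ?_, fun h K _ _ k hk ↦ ?_⟩
    · rw [smul_mem_smul_top_iff_tmul_eq_zero] at hr
      exact Ideal.Quotient.eq_zero_iff_mem.mp (h _ _ hr)
    obtain ⟨N, hkN, hN, h0⟩ := TensorProduct.exists_fg_tmul_eq_zero hk
    have : Module.Finite R N := Module.Finite.iff_fg.mpr hN
    suffices (⟨k, hkN⟩ : N) = 0 from congrArg Subtype.val this
    rw [← Submodule.mem_bot R, ← Ideal.iInf_pow_smul_eq_bot_of_isLocalRing (maximalIdeal R)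
      (maximalIdeal.isMaximal R).ne_top, Submodule.mem_iInf]
    intro n
    obtain ⟨t, ht⟩ := hcofinal n
    refine Submodule.smul_mono_left ht ?_
    by_contra hmem
    obtain ⟨φ, hφ⟩ := exists_linearMap_quotient_apply_ne_zero (hprimary t) (hGor t).1 (hGor t).2
      hmem
    obtain ⟨r, hr⟩ := Ideal.Quotient.mk_surjective (φ ⟨k, hkN⟩)
    have h0' := congrArg (φ.lTensor M) h0
    rw [LinearMap.lTensor_tmul, map_zero, ← hr, ← smul_mem_smul_top_iff_tmul_eq_zero] at h0'
    exact hφ (hr ▸ Ideal.Quotient.eq_zero_iff_mem.mpr (h t r h0'))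
  refine ⟨hpure.trans ⟨fun h t ht ↦ (hGor t).1 (h t _ ht), fun h t r hr ↦ ?_⟩, hpure⟩
  by_contra hrI
  obtain ⟨s, hs⟩ := exists_mul_sub_mem_of_notMem (hprimary t) (hGor t).2 hrI
  refine h t ?_
  have : u t • x = s • r • x - (s * r - u t) • x := by rw [smul_smul, sub_smul, sub_sub_cancel]
  rw [this]
  exact sub_mem (Submodule.smul_mem _ s hr) (Submodule.smul_mem_smul hs Submodule.mem_top)
end

section
/- Let S be a perfect ring of characteristic p > 0, f ∈ S, and T an integral S-algebra which is perfect, such that T[1/f] is finite étale over S[1/f] of constant rank r. Then for every ε in the ideal (f^{1/p^∞}) (generated by all p-power roots of f), there exist k ∈ ℕ and S-linear maps φ_ε: T → S^{⊕k} and ψ_ε: S^{⊕k} → T with ψ_ε ∘ φ_ε = ε·id_T; that is, T is f-almost finitely presented projective over S. -/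
universe u

open IsLocalRing TensorProduct

namespace PerfectRing

open Function

universe v

variable (p : ℕ)

theorem isReduced [Fact p.Prime] (S : Type*) [CommRing S] [ExpChar S p] [PerfectRing S p] :
    IsReduced S where
  eq_zero x hx := by
    obtain ⟨n, hn⟩ := hx
    refine (bijective_iterateFrobenius S p n).1 ?_
    rw [iterateFrobenius_def, map_zero]
    exact pow_eq_zero_of_le (Nat.lt_pow_self (Fact.out : p.Prime).one_lt).le hn

/-- A localization of a perfect ring away from an element is perfect. -/
theorem of_isLocalizationAway [Fact p.Prime] {S R : Type u} [CommRing S] [CommRing R] [Algebra S R]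
    [ExpChar S p] [PerfectRing S p] [ExpChar R p] (f : S) [IsLocalization.Away f R] :
    PerfectRing R p := by
  have : IsReduced S := isReduced p S
  have : IsReduced R := isReduced_localizationPreserves (Submonoid.powers f) R this
  refine PerfectRing.ofSurjective R p fun x ↦ ?_
  obtain ⟨n, s, hs⟩ := IsLocalization.Away.surj f x
  have hu : IsUnit (algebraMap S R f) := IsLocalization.Away.algebraMap_isUnit f
  obtain ⟨q, hq⟩ : ∃ q, p = q + 1 := ⟨p - 1, (Nat.succ_pred (expChar_ne_zero R p)).symm⟩
  obtain ⟨v, hv⟩ := surjective_frobenius S p (f ^ (n * q) * s)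
  obtain ⟨w, hw⟩ := (hu.pow n).exists_right_inv
  refine ⟨algebraMap S R v * w, ?_⟩
  rw [frobenius_def] at hv
  rw [frobenius_def, mul_pow, ← map_pow, hv, map_mul, map_pow, ← hs, pow_mul]
  set F := algebraMap S R f ^ n
  calc F ^ q * (x * F) * w ^ p = x * (F * w) ^ p := by rw [hq]; ring
    _ = x := by rw [hw, one_pow, mul_one]

theorem mem_range_of_pow_mem_range {S R : Type*} [CommRing S] [CommRing R] [ExpChar S p]
    [PerfectRing S p] [ExpChar R p] [PerfectRing R p] (g : S →+* R) (n : ℕ) {x : R}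
    (hx : x ^ p ^ n ∈ g.range) : x ∈ g.range := by
  obtain ⟨u, hu⟩ := hx
  obtain ⟨v, rfl⟩ := (bijective_iterateFrobenius S p n).2 u
  refine ⟨v, (bijective_iterateFrobenius R p n).1 ?_⟩
  simpa [iterateFrobenius_def] using hu

theorem mul_eq_mul_of_algebraMap_eq {S R : Type*} [CommRing S] [CommRing R] [Algebra S R]
    [IsReduced S] {f : S} [IsLocalization.Away f R] {h : S} {m : ℕ} (hf : h ^ m = f) {a b : S}
    (hab : algebraMap S R a = algebraMap S R b) : h * a = h * b := by
  obtain ⟨k, hk⟩ := IsLocalization.Away.exists_of_eq f hab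
  rw [← sub_eq_zero, ← mul_sub]
  refine IsNilpotent.eq_zero ⟨m * k + 1, ?_⟩
  have : f ^ k * (a - b) = 0 := by rw [mul_sub, hk, sub_self]
  rw [mul_pow, pow_succ, pow_succ (a - b), pow_mul, hf]
  linear_combination h * (a - b) ^ (m * k) * this

theorem exists_pow_mul_mem_range {S R : Type*} [CommRing S] [CommRing R] [Algebra S R]
    (f : S) [IsLocalization.Away f R] {P : Submodule S R} (hP : P.FG) :
    ∃ N : ℕ, ∀ x ∈ P, algebraMap S R f ^ N * x ∈ (algebraMap S R).range := by
  obtain ⟨_, ⟨N, rfl⟩, h⟩ := FractionalIdeal.isFractional_of_fg (S := Submonoid.powers f) hP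
  refine ⟨N, fun x hx ↦ ?_⟩
  obtain ⟨y, hy⟩ := h x hx
  exact ⟨y, by rw [hy, Algebra.smul_def, map_pow]⟩

theorem _root_.CharP.of_ringHom_of_prime [Fact p.Prime] {S R : Type*} [CommRing S] [CommRing R]
    [CharP S p] [Nontrivial R] (g : S →+* R) : CharP R p := by
  obtain ⟨q, hq⟩ := CharP.exists R
  rcases (Nat.dvd_prime Fact.out).1 (CharP.dvd_of_ringHom g p q) with rfl | rfl
  · exact absurd rfl (CharP.char_ne_one R 1)
  · exact hq

/-- The coordinates of the integral elements of a finite projective algebra `A` over `R = S[1/f]`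
have bounded denominators when `S` and `A` are perfect. -/
theorem exists_pow_mul_coord_mem_range [Fact p.Prime] {S R : Type u} {T A : Type v} {ι : Type*}
    [CommRing S] [CommRing T] [CommRing R] [CommRing A] [Algebra S T] [Algebra S R] [Algebra R A]
    [Algebra S A] [Algebra T A] [IsScalarTower S R A] [IsScalarTower S T A]
    [ExpChar S p] [PerfectRing S p] [ExpChar R p] [PerfectRing R p]
    [ExpChar A p] [PerfectRing A p] (f : S) [IsLocalization.Away f R] [Fintype ι]
    {b : ι → A} {l : ι → A →ₗ[R] R} [Algebra.IsIntegral S T]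
    (hb : ∀ x, ∑ i, l i x • b i = x) :
    ∃ N : ℕ, ∀ (t : T) (i : ι),
      algebraMap S R f ^ N * l i (algebraMap T A t) ∈ (algebraMap S R).range := by
  choose β hβ using fun i ↦ surjective_frobenius A p (b i)
  simp only [frobenius_def] at hβ
  obtain ⟨N, hN⟩ := exists_pow_mul_mem_range f (R := R)
    (Submodule.fg_span (R := S) (Set.finite_range fun q : ι × ι ↦ l q.1 (β q.2)))
  have hp : 2 ≤ p := (Fact.out : p.Prime).two_le
  set F := algebraMap S R f
  have hF : F ∈ (algebraMap S R).range := ⟨f, rfl⟩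
  let D : Set A := {x | ∀ i, F ^ (2 * N) * l i x ∈ (algebraMap S R).range}
  have hD_root (x : A) (hx : x ^ p ∈ D) : x ∈ D := by
    choose r hr using fun j ↦ surjective_frobenius R p (l j (x ^ p))
    simp only [frobenius_def] at hr
    have hx' : x = ∑ j, r j • β j := by
      refine injective_frobenius A p ?_
      rw [frobenius_def, map_sum]
      simp only [frobenius_def, smul_pow, hr, hβ, hb]
    intro k
    have : F ^ (2 * N) * l k x = ∑ j, (F ^ N * r j) * (F ^ N * l k (β j)) := by
      conv_lhs => rw [hx', map_sum, Finset.mul_sum]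
      refine Finset.sum_congr rfl fun j _ ↦ ?_
      rw [map_smul, smul_eq_mul]
      ring
    rw [this]
    refine sum_mem fun j _ ↦ mul_mem ?_ (hN _ (Submodule.subset_span ⟨(k, j), rfl⟩))
    refine mem_range_of_pow_mem_range p _ 1 ?_
    obtain ⟨q, rfl⟩ := Nat.exists_eq_add_of_le hp
    have : (F ^ N * r j) ^ (2 + q) ^ 1 = F ^ (q * N) * (F ^ (2 * N) * l j (x ^ (2 + q))) := by
      rw [pow_one, mul_pow, hr]
      ring
    rw [this]
    exact mul_mem (pow_mem hF _) (hx j)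
  have hD_iter (n : ℕ) (x : A) (hx : x ^ p ^ n ∈ D) : x ∈ D := by
    induction n with
    | zero => simpa using hx
    | succ n ih => exact ih (hD_root _ (by rwa [← pow_mul, ← pow_succ]))
  refine ⟨2 * N + 1, fun t i ↦ ?_⟩
  have hfg : (⨆ i, (Subalgebra.toSubmodule (Algebra.adjoin S {t})).map
      ((l i).restrictScalars S ∘ₗ (IsScalarTower.toAlgHom S T A).toLinearMap)).FG :=
    Submodule.fg_iSup _ fun i ↦ (Algebra.IsIntegral.isIntegral t).fg_adjoin_singleton.map _
  obtain ⟨M, hM⟩ := exists_pow_mul_mem_range f hfg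
  obtain ⟨n, hn⟩ : ∃ n, M ≤ p ^ n := ⟨M, (Nat.lt_pow_self hp).le⟩
  have key : algebraMap R A F * algebraMap T A t ∈ D := by
    refine hD_iter n _ fun j ↦ ?_
    have h1 := hM (l j (algebraMap T A (t ^ p ^ n))) (Submodule.mem_iSup_of_mem j
      ⟨t ^ p ^ n, pow_mem (Algebra.self_mem_adjoin_singleton S t) _, rfl⟩)
    obtain ⟨c, hc⟩ := Nat.exists_eq_add_of_le hn
    have : F ^ (2 * N) * l j ((algebraMap R A F * algebraMap T A t) ^ p ^ n) =
        F ^ (2 * N + c) * (F ^ M * l j (algebraMap T A (t ^ p ^ n))) := by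
      have : (algebraMap R A F * algebraMap T A t) ^ p ^ n =
          F ^ p ^ n • algebraMap T A (t ^ p ^ n) := by
        rw [mul_pow, Algebra.smul_def, map_pow, map_pow]
      rw [this, map_smul, smul_eq_mul]
      generalize l j (algebraMap T A (t ^ p ^ n)) = y
      rw [hc]
      ring
    rw [this]
    exact mul_mem (pow_mem hF _) h1
  have := key i
  rwa [← Algebra.smul_def, map_smul, smul_eq_mul, ← mul_assoc, ← pow_succ] at this

/-- A finite projective algebra over `S[1/f]` which is the localization of a perfect integral
`S`-algebra `T` gives factorizations of multiplication by `p`-power roots of `f` on `T` through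
finite free `S`-modules. -/
theorem exists_comp_eq_smul_id [Fact p.Prime] {S R : Type u} {T A : Type v} [CommRing S] [CommRing T]
    [CommRing R] [CommRing A]
    [Algebra S T] [Algebra S R] [Algebra R A] [Algebra S A] [Algebra T A]
    [IsScalarTower S R A] [IsScalarTower S T A] [ExpChar S p] [PerfectRing S p]
    [ExpChar T p] [PerfectRing T p] [ExpChar R p] [ExpChar A p]
    (f : S) [IsLocalization.Away f R] [IsLocalization.Away (algebraMap S T f) A]
    [Algebra.IsIntegral S T] [Module.Finite R A] [Module.Projective R A]
    {g : S} {e : ℕ} (hg : g ^ p ^ e = f) :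
    ∃ (k : ℕ) (φ : T →ₗ[S] (Fin k → S)) (ψ : (Fin k → S) →ₗ[S] T),
      ψ ∘ₗ φ = g • LinearMap.id := by
  have : PerfectRing R p := of_isLocalizationAway p f
  have : PerfectRing A p := of_isLocalizationAway p (algebraMap S T f)
  have : IsReduced S := isReduced p S
  have : IsReduced T := isReduced p T
  obtain ⟨k, β, α, -, -, hβα⟩ := Module.Finite.exists_comp_eq_id_of_projective R A
  let b (i : Fin k) : A := β (Pi.single i 1)
  let l (i : Fin k) : A →ₗ[R] R := LinearMap.proj i ∘ₗ α
  have hb (x : A) : ∑ i, l i x • b i = x := by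
    simp only [l, b, ← map_smul, ← map_sum, LinearMap.comp_apply, LinearMap.proj_apply]
    rw [← pi_eq_sum_univ' (α x)]
    exact LinearMap.congr_fun hβα x
  obtain ⟨N, hN⟩ := exists_pow_mul_coord_mem_range p (T := T) f hb
  obtain ⟨M, hM⟩ := exists_pow_mul_mem_range (algebraMap S T f) (R := A)
    (Submodule.fg_span (R := T) (Set.finite_range b))
  replace hM (i : Fin k) := hM (b i) (Submodule.subset_span ⟨i, rfl⟩)
  have hp : 2 ≤ p := (Fact.out : p.Prime).two_le
  obtain ⟨d, hd⟩ : ∃ d, N + M + 2 ≤ p ^ d := ⟨_, (Nat.lt_pow_self hp).le⟩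
  obtain ⟨c, hc⟩ := Nat.exists_eq_add_of_le hd
  obtain ⟨h, hh⟩ := (bijective_iterateFrobenius S p d).2 g
  rw [iterateFrobenius_def] at hh
  set n := d + e
  have hhf : h ^ p ^ n = f := by rw [pow_add, pow_mul, hh, hg]
  have hhf' : algebraMap S T h ^ p ^ n = algebraMap S T f := by rw [← map_pow, hhf]
  let ρR := (iterateFrobeniusEquiv R p n).symm
  let ρA := (iterateFrobeniusEquiv A p n).symm
  have hρR (x : R) : ρR x ^ p ^ n = x := (iterateFrobeniusEquiv R p n).apply_symm_apply x
  have hρA (x : A) : ρA x ^ p ^ n = x := (iterateFrobeniusEquiv A p n).apply_symm_apply x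
  have hρR' (x : R) : ρR (x ^ p ^ n) = x := (iterateFrobeniusEquiv R p n).symm_apply_apply x
  let L (i : Fin k) (x : A) : R := ρR (l i (x ^ p ^ n))
  have hL_add (i : Fin k) (x y : A) : L i (x + y) = L i x + L i y := by
    simp only [L, add_pow_expChar_pow, map_add]
  have hL_smul (i : Fin k) (r : R) (x : A) : L i (r • x) = r * L i x := by
    simp only [L, smul_pow, map_smul, smul_eq_mul, map_mul, hρR']
  have hL (x : A) : ∑ i, L i x • ρA (b i) = x := by
    refine (bijective_iterateFrobenius A p n).1 ?_
    rw [map_sum]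
    simp only [iterateFrobenius_def, smul_pow, L, hρR, hρA, hb]
  have hLt (t : T) (i : Fin k) :
      algebraMap S R h ^ N * L i (algebraMap T A t) ∈ (algebraMap S R).range := by
    refine mem_range_of_pow_mem_range p _ n ?_
    rw [mul_pow, pow_right_comm, ← map_pow, hhf]
    simp only [L, hρR, ← map_pow (algebraMap T A)]
    exact hN _ i
  choose u hu using hLt
  have hbt (i : Fin k) :
      algebraMap T A (algebraMap S T h) ^ M * ρA (b i) ∈ (algebraMap T A).range := by
    refine mem_range_of_pow_mem_range p _ n ?_
    rw [mul_pow, pow_right_comm, ← map_pow, hhf', hρA]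
    exact hM i
  choose v hv using hbt
  let φ : T →ₗ[S] (Fin k → S) :=
    { toFun t i := h * u t i
      map_add' s t := by
        funext i
        rw [Pi.add_apply, ← mul_add]
        refine mul_eq_mul_of_algebraMap_eq (R := R) hhf ?_
        simp only [map_add, hu, hL_add, mul_add]
      map_smul' s t := by
        funext i
        rw [Pi.smul_apply, smul_eq_mul, RingHom.id_apply, mul_left_comm]
        refine mul_eq_mul_of_algebraMap_eq (R := R) hhf ?_
        have : algebraMap T A (s • t) = algebraMap S R s • algebraMap T A t := by
          rw [algebraMap_smul, Algebra.smul_def s t, map_mul, ← IsScalarTower.algebraMap_apply,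
            ← Algebra.smul_def]
        rw [map_mul, hu, hu, this, hL_smul, mul_left_comm] }
  let ψ : (Fin k → S) →ₗ[S] T := Fintype.linearCombination S fun i ↦ (h * h ^ c) • v i
  refine ⟨k, φ, ψ, LinearMap.ext fun t ↦ ?_⟩
  have key : algebraMap S T h * ∑ i, algebraMap S T (h * h ^ c * u t i) * v i =
      algebraMap S T h * (algebraMap S T (h ^ (N + M + 1 + c)) * t) := by
    refine mul_eq_mul_of_algebraMap_eq (R := A) hhf' ?_
    simp only [map_sum, map_mul, hv]
    conv_rhs => rw [← hL (algebraMap T A t), Finset.mul_sum]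
    refine Finset.sum_congr rfl fun i _ ↦ ?_
    have := congr_arg (algebraMap R A) (hu t i)
    simp only [← IsScalarTower.algebraMap_apply, map_mul, map_pow] at this ⊢
    rw [this, Algebra.smul_def]
    ring
  simp only [ψ, φ, LinearMap.comp_apply, LinearMap.coe_mk, AddHom.coe_mk,
    Fintype.linearCombination_apply, LinearMap.smul_apply, LinearMap.id_apply]
  rw [Algebra.smul_def g t, ← hh, hc]
  calc _ = algebraMap S T h * ∑ i, algebraMap S T (h * h ^ c * u t i) * v i := by
        rw [Finset.mul_sum]
        refine Finset.sum_congr rfl fun i _ ↦ ?_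
        simp only [Algebra.smul_def, map_mul, map_pow]
        ring
    _ = _ := by
        rw [key]
        simp only [map_pow]
        ring

theorem exists_dvd_of_mem_span_roots {S : Type*} [CommRing S] [ExpChar S p]
    [PerfectRing S p] {f ε : S} (hε : ε ∈ Ideal.span {y : S | ∃ e : ℕ, y ^ p ^ e = f}) :
    ∃ (g : S) (e : ℕ), g ^ p ^ e = f ∧ g ∣ ε := by
  induction hε using Submodule.span_induction with
  | mem x hx => exact ⟨x, hx.choose, hx.choose_spec, dvd_rfl⟩
  | zero => exact ⟨f, 0, by simp, dvd_zero _⟩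
  | smul a x _ hx =>
    obtain ⟨g, e, hg, hgx⟩ := hx
    exact ⟨g, e, hg, hgx.mul_left a⟩
  | add x y _ _ hx hy =>
    obtain ⟨g₁, e₁, h₁, d₁⟩ := hx
    obtain ⟨g₂, e₂, h₂, d₂⟩ := hy
    clear * - h₁ h₂ d₁ d₂
    wlog hle : e₁ ≤ e₂ generalizing x y g₁ g₂ e₁ e₂
    · rw [add_comm]
      exact this y x g₂ e₂ h₂ d₂ g₁ e₁ h₁ d₁ (le_of_not_ge hle)
    obtain ⟨d, rfl⟩ := Nat.exists_eq_add_of_le hle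
    have : g₁ = g₂ ^ p ^ d := by
      refine (bijective_iterateFrobenius S p e₁).1 ?_
      rw [iterateFrobenius_def, iterateFrobenius_def, ← pow_mul, h₁, ← pow_add, add_comm d, h₂]
    refine ⟨g₂, e₁ + d, h₂, dvd_add (dvd_trans ?_ d₁) d₂⟩
    rw [this]
    exact dvd_pow_self _ (pow_ne_zero _ (expChar_ne_zero S p))

end PerfectRing

/-- **Almost projectivity in characteristic `p` (uniform version of the almost purity
theorem).**  Let `S` be a perfect ring of characteristic `p > 0`, `f ∈ S`, and `T` an
integral `S`-algebra which is perfect, such that `T[1/f]` is finite étale over `S[1/f]` of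
constant rank `r`.  Then for every `ε` in the ideal `(f^{1/p^∞})` generated by all `p`-power
roots of `f`, there exist `k ∈ ℕ` and `S`-linear maps `φ_ε : T → S^{⊕k}` and
`ψ_ε : S^{⊕k} → T` with `ψ_ε ∘ φ_ε = ε·id_T`; that is, `T` is `f`-almost finitely presented
projective over `S`. -/
theorem almost_projective_of_perfect (p : ℕ) [Fact p.Prime]
    (S : Type u) [CommRing S] [CharP S p] [ExpChar S p] [PerfectRing S p]
    (T : Type u) [CommRing T] [CharP T p] [ExpChar T p] [PerfectRing T p]
    [Algebra S T] [Algebra.IsIntegral S T] (f : S) (r : ℕ)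
    -- the localizations `S[1/f]` and `T[1/f]`
    (Sf : Type u) [CommRing Sf] [Algebra S Sf] [IsLocalization.Away f Sf]
    (Tf : Type u) [CommRing Tf] [Algebra T Tf] [IsLocalization.Away (algebraMap S T f) Tf]
    [Algebra S Tf] [IsScalarTower S T Tf] [Algebra Sf Tf] [IsScalarTower S Sf Tf]
    -- `T[1/f]` is finite étale over `S[1/f]` …
    [Module.Finite Sf Tf] [Algebra.Etale Sf Tf]
    -- … of constant rank `r`
    (hrank : ∀ (P : Ideal Sf) (_ : P.IsPrime),
      Module.finrank (ResidueField (Localization.AtPrime P))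
        ((ResidueField (Localization.AtPrime P)) ⊗[Sf] Tf) = r) :
    ∀ ε ∈ Ideal.span {y : S | ∃ e : ℕ, y ^ p ^ e = f},
      ∃ (k : ℕ) (φ : T →ₗ[S] (Fin k → S)) (ψ : (Fin k → S) →ₗ[S] T),
        ψ.comp φ = ε • LinearMap.id := by
  intro ε hε
  obtain ⟨g, e, hg, a, rfl⟩ := PerfectRing.exists_dvd_of_mem_span_roots p hε
  suffices h : ∃ (k : ℕ) (φ : T →ₗ[S] (Fin k → S)) (ψ : (Fin k → S) →ₗ[S] T),
      ψ ∘ₗ φ = g • LinearMap.id by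
    obtain ⟨k, φ, ψ, h⟩ := h
    exact ⟨k, a • φ, ψ, by rw [LinearMap.comp_smul, h, smul_smul, mul_comm]⟩
  rcases subsingleton_or_nontrivial Tf with hTf | hTf
  · refine ⟨0, 0, 0, LinearMap.ext fun t ↦ ?_⟩
    have : IsReduced T := PerfectRing.isReduced p T
    have hg' : algebraMap S T g ^ p ^ e = algebraMap S T f := by rw [← map_pow, hg]
    have := PerfectRing.mul_eq_mul_of_algebraMap_eq (R := Tf) hg'
      (Subsingleton.elim (algebraMap T Tf t) (algebraMap T Tf 0))
    simpa [Algebra.smul_def] using this.symm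
  have : Nontrivial Sf := (algebraMap Sf Tf).domain_nontrivial
  have : CharP Sf p := CharP.of_ringHom_of_prime p (algebraMap S Sf)
  have : CharP Tf p := CharP.of_ringHom_of_prime p (algebraMap T Tf)
  have : Module.FinitePresentation Sf Tf :=
    Module.FinitePresentation.of_finite_of_finitePresentation Sf Tf
  have : Module.Projective Sf Tf := Module.Flat.projective_of_finitePresentation
  exact PerfectRing.exists_comp_eq_smul_id p (R := Sf) (A := Tf) f hg
end
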